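/- Let k be a field of characteristic zero and (R, Δ) a commutative differential k-algebra with R noetherian, dim_k R < |k|, and |Δ| < |k|. For a Δ-prime ideal P of R, the following are equivalent: (i) P is Δ-primitive; (ii) P is Δ-rational; (iii) P is |k|-separable in Δ-spec R. -/

import Mathlib

universe u

section DifferentialAlgebra

variable (k R : Type u) [Field k] [CommRing R] [Algebra k R]

/-- `I` is a `Δ`-ideal: it is stable under every derivation in `Δ`. -/
def IsDeltaIdeal (Δ : Set (Derivation k R R)) (I : Ideal R) : Prop :=
  ∀ δ ∈ Δ, ∀ x ∈ I, δ x ∈ I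

/-- `P` is a `Δ`-prime ideal: a prime ideal which is a `Δ`-ideal. -/
def IsDeltaPrime (Δ : Set (Derivation k R R)) (P : Ideal R) : Prop :=
  P.IsPrime ∧ IsDeltaIdeal k R Δ P

/-- The `Δ`-core of an ideal `J`: the largest `Δ`-ideal contained in `J`. -/
def deltaCore (Δ : Set (Derivation k R R)) (J : Ideal R) : Ideal R :=
  sSup {I : Ideal R | IsDeltaIdeal k R Δ I ∧ I ≤ J}

/-- `P` is `Δ`-primitive: it is the `Δ`-core of some maximal ideal. -/
def IsDeltaPrimitive (Δ : Set (Derivation k R R)) (P : Ideal R) : Prop :=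
  ∃ M : Ideal R, M.IsMaximal ∧ deltaCore k R Δ M = P

/-- `Δ`-spec `R`: the set of `Δ`-prime ideals, topologized as a subspace of `Spec R`. -/
abbrev DeltaSpec (Δ : Set (Derivation k R R)) : Type u :=
  {P : PrimeSpectrum R // IsDeltaIdeal k R Δ P.asIdeal}

/-- `P` is `Δ`-rational: whenever `a, b ∈ R` with `b ∉ P` are such that the class of `a/b` in
`Frac(R/P)` is killed by all the induced derivations, that class is algebraic over `k`. -/
def IsDeltaRational (Δ : Set (Derivation k R R)) (P : Ideal R) (hP : P.IsPrime) : Prop :=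
  haveI := hP
  ∀ a b : R, b ∉ P → (∀ δ ∈ Δ, δ a * b - a * δ b ∈ P) →
    IsAlgebraic k
      (algebraMap (R ⧸ P) (FractionRing (R ⧸ P)) (Ideal.Quotient.mk P a) /
       algebraMap (R ⧸ P) (FractionRing (R ⧸ P)) (Ideal.Quotient.mk P b))

/-- `P` is `κ`-separable in `Δ`-spec `R`: there is a set `Λ`, of cardinality `< κ`, of `Δ`-prime
ideals properly containing `P`, such that every `Δ`-prime ideal properly containing `P` contains
a member of `Λ`. -/
def DeltaSeparable (Δ : Set (Derivation k R R)) (κ : Cardinal.{u}) (P : Ideal R) : Prop :=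
  ∃ Λ : Set (Ideal R), (∀ Q ∈ Λ, IsDeltaPrime k R Δ Q ∧ P < Q) ∧
    Cardinal.mk Λ < κ ∧
    ∀ Q : Ideal R, IsDeltaPrime k R Δ Q → P < Q → ∃ Q' ∈ Λ, Q' ≤ Q

/-- `R` satisfies the `Δ`-Dixmier–Moeglin equivalence: for every `Δ`-prime ideal `P`, the
conditions "`{P}` is locally closed in `Δ`-spec `R`", "`P` is `Δ`-primitive", and
"`P` is `Δ`-rational" are equivalent. -/
def DeltaDME (Δ : Set (Derivation k R R)) : Prop :=
  ∀ (P : PrimeSpectrum R) (hP : IsDeltaIdeal k R Δ P.asIdeal),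
    (IsLocallyClosed ({⟨P, hP⟩} : Set (DeltaSpec k R Δ)) ↔ IsDeltaPrimitive k R Δ P.asIdeal) ∧
    (IsDeltaPrimitive k R Δ P.asIdeal ↔ IsDeltaRational k R Δ P.asIdeal P.isPrime)

end DifferentialAlgebra

section DeltaIdeals

variable {k R : Type u} [Field k] [CommRing R] [Algebra k R] {Δ : Set (Derivation k R R)}

theorem isDeltaIdeal_sInf {S : Set (Ideal R)} (hS : ∀ I ∈ S, IsDeltaIdeal k R Δ I) :
    IsDeltaIdeal k R Δ (sInf S) := fun δ hδ x hx =>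
  Submodule.mem_sInf.2 fun I hI => hS I hI δ hδ x (Submodule.mem_sInf.1 hx I hI)

theorem isDeltaIdeal_sSup {S : Set (Ideal R)} (hS : ∀ I ∈ S, IsDeltaIdeal k R Δ I) :
    IsDeltaIdeal k R Δ (sSup S) := by
  intro δ hδ x hx
  rw [sSup_eq_iSup'] at hx ⊢
  induction hx using Submodule.iSup_induction' with
  | mem I x hx => exact Submodule.mem_iSup_of_mem I (hS I I.2 δ hδ x hx)
  | zero => simp
  | add x y _ _ hx hy => rw [map_add]; exact add_mem hx hy

theorem isDeltaIdeal_deltaCore (J : Ideal R) : IsDeltaIdeal k R Δ (deltaCore k R Δ J) :=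
  isDeltaIdeal_sSup fun _ hI => hI.1

theorem deltaCore_le (J : Ideal R) : deltaCore k R Δ J ≤ J := sSup_le fun _ hI => hI.2

theorem IsDeltaIdeal.le_deltaCore {I J : Ideal R} (hI : IsDeltaIdeal k R Δ I) (h : I ≤ J) :
    I ≤ deltaCore k R Δ J := le_sSup ⟨hI, h⟩

theorem Ideal.exists_mul_pow_mem_of_mem_minimalPrimes {A : Type*} [CommRing A] {I p : Ideal A}
    (hp : p ∈ I.minimalPrimes) {x : A} (hx : x ∈ p) : ∃ s ∉ p, ∃ n : ℕ, s * x ^ n ∈ I := by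
  have := hp.1.1
  by_contra! h
  have hd : Disjoint (I : Set A) (p.primeCompl ⊔ Submonoid.powers x : Submonoid A) := by
    refine Set.disjoint_right.2 fun y hy hyI => ?_
    obtain ⟨s, hs, _, ⟨n, rfl⟩, rfl⟩ := Submonoid.mem_sup.1 hy
    exact h s hs n hyI
  obtain ⟨q, hq, hIq, hqd⟩ := Ideal.exists_le_prime_disjoint I _ hd
  have hqp : q ≤ p := fun y hy => by
    by_contra hyp
    exact Set.disjoint_left.1 hqd hy (Submonoid.mem_sup_left hyp)
  exact Set.disjoint_left.1 hqd (hp.2 ⟨hq, hIq⟩ hqp hx)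
    (Submonoid.mem_sup_right (Submonoid.mem_powers x))

theorem IsDeltaIdeal.of_mem_minimalPrimes [CharZero k] {I p : Ideal R}
    (hI : IsDeltaIdeal k R Δ I) (hp : p ∈ I.minimalPrimes) : IsDeltaIdeal k R Δ p := by
  classical
  have := hp.1.1
  intro δ hδ x hx
  have hex : ∃ n : ℕ, ∃ s ∉ p, s * x ^ n ∈ I := by
    obtain ⟨s, hs, n, h⟩ := Ideal.exists_mul_pow_mem_of_mem_minimalPrimes hp hx
    exact ⟨n, s, hs, h⟩
  by_contra hδx
  obtain ⟨s, hs, hsI⟩ := Nat.find_spec hex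
  cases hn : Nat.find hex with
  | zero =>
    rw [hn, pow_zero, mul_one] at hsI
    exact hs (hp.1.2 hsI)
  | succ n =>
    refine Nat.find_min hex (m := n) (by omega) ⟨s * s * δ x, ?_, ?_⟩
    · exact this.mul_notMem (this.mul_notMem hs hs) hδx
    · rw [hn] at hsI
      have h1 : s * δ (s * x ^ (n + 1)) - δ s * (s * x ^ (n + 1)) ∈ I :=
        sub_mem (I.mul_mem_left _ (hI δ hδ _ hsI)) (I.mul_mem_left _ hsI)
      have h2 : s * δ (s * x ^ (n + 1)) - δ s * (s * x ^ (n + 1)) =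
          ((n + 1 : ℕ) : k) • (s * s * δ x * x ^ n) := by
        rw [Derivation.leibniz, Derivation.leibniz_pow, Nat.cast_smul_eq_nsmul]
        simp only [smul_eq_mul, nsmul_eq_mul, Nat.add_sub_cancel]
        ring
      rw [h2] at h1
      have h3 := Submodule.smul_of_tower_mem I (((n + 1 : ℕ) : k)⁻¹) h1
      rwa [inv_smul_smul₀ (Nat.cast_ne_zero.2 n.succ_ne_zero)] at h3

theorem deltaCore_isPrime [CharZero k] (M : Ideal R) [M.IsPrime] :
    (deltaCore k R Δ M).IsPrime := by
  obtain ⟨p, hp, hpM⟩ := Ideal.exists_minimalPrimes_le (deltaCore_le (Δ := Δ) M)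
  have hp' : IsDeltaIdeal k R Δ p := (isDeltaIdeal_deltaCore M).of_mem_minimalPrimes hp
  rw [le_antisymm hp.1.2 (hp'.le_deltaCore hpM)]
  exact hp.1.1

/-- A `Δ`-prime ideal `P` is `κ`-separable exactly when fewer than `κ` elements outside `P` suffice
to detect the `Δ`-prime ideals properly containing `P`. -/
theorem deltaSeparable_iff_exists_set [CharZero k] [IsNoetherianRing R] {P : Ideal R}
    {κ : Cardinal.{u}} (hκ : Cardinal.aleph0 ≤ κ) :
    DeltaSeparable k R Δ κ P ↔ ∃ S : Set R, (∀ s ∈ S, s ∉ P) ∧ Cardinal.mk S < κ ∧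
      ∀ Q : Ideal R, IsDeltaPrime k R Δ Q → P < Q → ∃ s ∈ S, s ∈ Q := by
  constructor
  · rintro ⟨Λ, hΛ, hcard, h⟩
    choose f hfQ hfP using fun Q : Λ => SetLike.exists_of_lt (hΛ Q Q.2).2
    refine ⟨Set.range f, ?_, Cardinal.mk_range_le.trans_lt hcard, fun Q hQ hPQ => ?_⟩
    · rintro _ ⟨Q, rfl⟩
      exact hfP Q
    · obtain ⟨Q', hQ', hle⟩ := h Q hQ hPQ
      exact ⟨_, ⟨⟨Q', hQ'⟩, rfl⟩, hle (hfQ ⟨Q', hQ'⟩)⟩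
  · rintro ⟨S, hS, hcard, h⟩
    let I : S → Ideal R := fun s => sInf {J | IsDeltaIdeal k R Δ J ∧ P ≤ J ∧ (s : R) ∈ J}
    have hI : ∀ s, IsDeltaIdeal k R Δ (I s) := fun s => isDeltaIdeal_sInf fun J hJ => hJ.1
    have hPI : ∀ s, P ≤ I s := fun s => le_sInf fun J hJ => hJ.2.1
    have hsI : ∀ s : S, (s : R) ∈ I s := fun s => Submodule.mem_sInf.2 fun J hJ => hJ.2.2
    refine ⟨⋃ s, (I s).minimalPrimes, ?_, ?_, fun Q hQ hPQ => ?_⟩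
    · intro Q hQ
      obtain ⟨s, hs⟩ := Set.mem_iUnion.1 hQ
      exact ⟨⟨hs.1.1, (hI s).of_mem_minimalPrimes hs⟩,
        SetLike.lt_iff_le_and_exists.2 ⟨(hPI s).trans hs.1.2, (s : R), hs.1.2 (hsI s), hS s s.2⟩⟩
    · have hfin : ∀ s, (I s).minimalPrimes.Finite := fun s =>
        Ideal.finite_minimalPrimes_of_isNoetherianRing R (I s)
      rcases finite_or_infinite S with hSf | hSi
      · exact (Set.finite_iUnion hfin).lt_aleph0.trans_le hκ
      · refine (Cardinal.mk_iUnion_le_sum_mk.trans ?_).trans_lt hcard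
        refine (Cardinal.sum_le_sum _ (fun _ => Cardinal.aleph0)
          fun s => (hfin s).lt_aleph0.le).trans ?_
        rw [Cardinal.sum_const', Cardinal.mul_aleph0_eq (Cardinal.aleph0_le_mk S)]
    · obtain ⟨s, hs, hsQ⟩ := h Q hQ hPQ
      have := hQ.1
      have hle : I ⟨s, hs⟩ ≤ Q := sInf_le ⟨hQ.2, hPQ.le, hsQ⟩
      obtain ⟨p, hp, hpQ⟩ := Ideal.exists_minimalPrimes_le hle
      exact ⟨p, Set.mem_iUnion.2 ⟨_, hp⟩, hpQ⟩

end DeltaIdeals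

theorem Algebra.isAlgebraic_of_rank_lt_mk {F E : Type u} [Field F] [Field E] [Algebra F E]
    (h : Module.rank F E < Cardinal.mk F) : Algebra.IsAlgebraic F E := by
  refine ⟨fun x => ?_⟩
  by_contra hx
  have hx' : Transcendental F x := hx
  exact h.not_ge hx'.linearIndependent_sub_inv.cardinal_le_rank

section ResidueField

/-- `K` is the fraction field of `R ⧸ P`, expressed through the structure map `R → K`. -/
structure IsResidueFractionField {R : Type*} [CommRing R] (P : Ideal R) (K : Type*) [Field K]
    [Algebra R K] : Prop where
  algebraMap_eq_zero_iff : ∀ r : R, algebraMap R K r = 0 ↔ r ∈ P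
  exists_mul_eq : ∀ x : K, ∃ a b : R, b ∉ P ∧ x * algebraMap R K b = algebraMap R K a

theorem isResidueFractionField_fractionRing {R : Type*} [CommRing R] (P : Ideal R) [P.IsPrime] :
    IsResidueFractionField P (FractionRing (R ⧸ P)) where
  algebraMap_eq_zero_iff r := by
    rw [IsScalarTower.algebraMap_apply R (R ⧸ P) (FractionRing (R ⧸ P)),
      FaithfulSMul.algebraMap_eq_zero_iff, Ideal.Quotient.algebraMap_eq,
      Ideal.Quotient.eq_zero_iff_mem]
  exists_mul_eq x := by
    obtain ⟨a, b, hb, rfl⟩ := IsFractionRing.div_surjective (A := R ⧸ P) x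
    obtain ⟨a, rfl⟩ := Ideal.Quotient.mk_surjective a
    obtain ⟨b, rfl⟩ := Ideal.Quotient.mk_surjective b
    have hb0 := nonZeroDivisors.ne_zero hb
    refine ⟨a, b, fun h => hb0 (Ideal.Quotient.eq_zero_iff_mem.2 h), ?_⟩
    exact div_mul_cancel₀ _ (by rwa [Ne, FaithfulSMul.algebraMap_eq_zero_iff])

variable {k R K : Type u} [Field k] [CommRing R] [Algebra k R] [Field K] [Algebra k K]
  [Algebra R K] [IsScalarTower k R K] {Δ : Set (Derivation k R R)} {P : Ideal R}

local notation "φ" => algebraMap R K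

namespace IsResidueFractionField

theorem exists_derivation (hK : IsResidueFractionField P K) (hP : P.IsPrime)
    (δ : Derivation k R R) (hδ : ∀ x ∈ P, δ x ∈ P) :
    ∃ D : Derivation k K K, ∀ r, D (φ r) = φ (δ r) := by
  choose num den hden hnd using hK.exists_mul_eq
  have hne : ∀ {b}, b ∉ P → φ b ≠ 0 := fun hb h => hb ((hK.algebraMap_eq_zero_iff _).1 h)
  let d : K → K := fun x => (φ (δ (num x)) - x * φ (δ (den x))) / φ (den x)
  have hd : ∀ {x : K} (y : K) (a b : R), b ∉ P → x * φ b = φ a →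
      y * φ b = φ (δ a) - x * φ (δ b) → d x = y := by
    intro x y a b hb hx hy
    have h0 : a * den x - num x * b ∈ P := by
      rw [← hK.algebraMap_eq_zero_iff, map_sub, map_mul, map_mul, ← hx, ← hnd]
      ring
    have h1 := (hK.algebraMap_eq_zero_iff _).2 (hδ _ h0)
    simp only [map_sub, Derivation.leibniz, smul_eq_mul, map_add, map_mul, ← hx, ← hnd] at h1
    have h2 := hne (hden x)
    have h3 := hne hb
    rw [div_eq_iff h2]
    refine mul_right_cancel₀ h3 ?_
    linear_combination -h1 - φ (den x) * hy
  have hspec : ∀ x, d x * φ (den x) = φ (δ (num x)) - x * φ (δ (den x)) := fun x =>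
    div_mul_cancel₀ _ (hne (hden x))
  have hsmul : ∀ (c : k) (r : R), φ (c • r) = c • φ r := fun c r => by
    rw [Algebra.smul_def, Algebra.smul_def, map_mul, ← IsScalarTower.algebraMap_apply]
  have hone : (1 : R) ∉ P := hP.one_notMem
  let L : K →ₗ[k] K :=
    { toFun := d
      map_add' := fun x y => by
        refine hd _ (num x * den y + num y * den x) (den x * den y)
          (hP.mul_notMem (hden x) (hden y)) ?_ ?_
        · simp only [map_add, map_mul, ← hnd]; ring
        · simp only [map_add, map_mul, Derivation.leibniz, smul_eq_mul, ← hnd]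
          linear_combination φ (den y) * hspec x + φ (den x) * hspec y
      map_smul' := fun c x => by
        refine hd _ (c • num x) (den x) (hden x) ?_ ?_
        · rw [hsmul, smul_mul_assoc, hnd]
        · rw [Derivation.map_smul, hsmul, RingHom.id_apply, smul_mul_assoc, hspec,
            smul_sub, smul_mul_assoc] }
  refine ⟨Derivation.mk' L fun x y => ?_, fun r => ?_⟩
  · refine hd _ (num x * num y) (den x * den y) (hP.mul_notMem (hden x) (hden y)) ?_ ?_
    · simp only [map_mul, ← hnd]; ring
    · change (x * d y + y * d x) * _ = _
      simp only [map_add, map_mul, Derivation.leibniz, smul_eq_mul, ← hnd]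
      linear_combination y * φ (den y) * hspec x + x * φ (den x) * hspec y
  · exact hd _ r 1 hone (by simp) (by simp)

end IsResidueFractionField

end ResidueField

section Constants

variable {F K ι : Type*} [Field F] [Field K] [Algebra F K]

/-- The subfield of `K` of elements killed by every derivation in the family `D`. -/
def derivationConstants (D : ι → Derivation F K K) : Subfield K where
  carrier := {x | ∀ i, D i x = 0}
  mul_mem' hx hy i := by simp [hx i, hy i]
  one_mem' i := by simp
  add_mem' hx hy i := by simp [hx i, hy i]
  zero_mem' i := by simp
  neg_mem' hx i := by simp [hx i]
  inv_mem' x hx i := by simp [Derivation.leibniz_inv, hx i]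

theorem mem_derivationConstants {D : ι → Derivation F K K} {x : K} :
    x ∈ derivationConstants D ↔ ∀ i, D i x = 0 := Iff.rfl

/-- A derivation of the family `D`, as a linear map over the constants of `D`. -/
def derivationConstantsLinear (D : ι → Derivation F K K) (i : ι) :
    Module.End (derivationConstants D) K where
  toFun := D i
  map_add' := map_add (D i)
  map_smul' c x := by
    have := c.2 i
    simp [Subfield.smul_def, this]

@[simp]
theorem derivationConstantsLinear_apply (D : ι → Derivation F K K) (i : ι) (x : K) :
    derivationConstantsLinear D i x = D i x := rfl

/-- A nonzero subspace of `K ^ n` stable under derivations of `K` acting coordinatewise contains a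
nonzero vector with constant coordinates. -/
theorem exists_mem_forall_mem_derivationConstants {n : Type*} [Finite n]
    (D : ι → Derivation F K K) (N : Submodule K (n → K))
    (hN : ∀ i, ∀ c ∈ N, (fun j => D i (c j)) ∈ N) (hN0 : N ≠ ⊥) :
    ∃ c ∈ N, c ≠ 0 ∧ ∀ j, c j ∈ derivationConstants D := by
  obtain ⟨c, hc, hc0⟩ := N.ne_bot_iff.1 hN0
  induction h : (Function.support c).ncard using Nat.strong_induction_on generalizing c with
  | _ m ih =>
    obtain ⟨j₀, hj₀⟩ := Function.ne_iff.1 hc0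
    have hc' : (c j₀)⁻¹ • c ∈ N := N.smul_mem _ hc
    by_cases hconst : ∀ j, ((c j₀)⁻¹ • c) j ∈ derivationConstants D
    · exact ⟨_, hc', smul_ne_zero (inv_ne_zero hj₀) hc0, hconst⟩
    · simp only [mem_derivationConstants, not_forall] at hconst
      obtain ⟨j, i, hji⟩ := hconst
      refine ih _ ?_ _ (hN i _ hc') (fun h0 => hji (congrFun h0 j)) rfl
      rw [← h]
      refine Set.ncard_lt_ncard (Set.ssubset_iff_exists.2 ⟨fun l hl hcl => hl ?_, j₀, hj₀, ?_⟩)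
        (Set.toFinite _)
      · simp [hcl]
      · have : ((c j₀)⁻¹ • c) j₀ = 1 := inv_mul_cancel₀ hj₀
        rw [Function.notMem_support, this, Derivation.map_one_eq_zero]

end Constants

section DifferentialOperators

variable {F R K ι : Type*} [Field F] [CommRing R] [Field K] [Algebra F K] [Algebra R K]

/-- The ring of operators on `K` generated by the multiplications by elements of `R` and by the
derivations of the family `D`. -/
def differentialOperators (R : Type*) [CommRing R] [Algebra R K] (D : ι → Derivation F K K) :
    Subring (Module.End (derivationConstants D) K) :=
  Subring.closure
    (Set.range (fun r : R => LinearMap.mulLeft (derivationConstants D) (algebraMap R K r)) ∪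
      Set.range (derivationConstantsLinear D))

theorem mulLeft_mem_differentialOperators (D : ι → Derivation F K K) (r : R) :
    LinearMap.mulLeft (derivationConstants D) (algebraMap R K r) ∈ differentialOperators R D :=
  Subring.subset_closure (.inl ⟨r, rfl⟩)

theorem derivationConstantsLinear_mem_differentialOperators (D : ι → Derivation F K K) (i : ι) :
    derivationConstantsLinear D i ∈ differentialOperators R D :=
  Subring.subset_closure (.inr ⟨i, rfl⟩)

/-- Differential operators preserve the images of differential ideals. -/
theorem exists_mem_of_mem_differentialOperators {D : ι → Derivation F K K} {Q : Ideal R}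
    (hQ : ∀ i, ∀ r ∈ Q, ∃ r' ∈ Q, D i (algebraMap R K r) = algebraMap R K r')
    {T : Module.End (derivationConstants D) K} (hT : T ∈ differentialOperators R D)
    {r : R} (hr : r ∈ Q) : ∃ r' ∈ Q, T (algebraMap R K r) = algebraMap R K r' := by
  induction hT using Subring.closure_induction generalizing r with
  | mem T hT =>
    rcases hT with ⟨a, rfl⟩ | ⟨i, rfl⟩
    · exact ⟨a * r, Q.mul_mem_left a hr, by simp⟩
    · exact hQ i r hr
  | zero => exact ⟨0, Q.zero_mem, by simp⟩
  | one => exact ⟨r, hr, rfl⟩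
  | add S T _ _ hS hT =>
    obtain ⟨a, ha, ha'⟩ := hS hr
    obtain ⟨b, hb, hb'⟩ := hT hr
    exact ⟨a + b, add_mem ha hb, by simp [ha', hb']⟩
  | neg T _ hT =>
    obtain ⟨a, ha, ha'⟩ := hT hr
    exact ⟨-a, neg_mem ha, by simp [ha']⟩
  | mul S T _ _ hS hT =>
    obtain ⟨a, ha, ha'⟩ := hT hr
    obtain ⟨b, hb, hb'⟩ := hS ha
    exact ⟨b, hb, by rw [Module.End.mul_apply, ha', hb']⟩

/-- Differential operators separate elements linearly independent over the constants. -/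
theorem exists_differentialOperator_separating {P : Ideal R} [hP : P.IsPrime]
    (hK : IsResidueFractionField P K) (D : ι → Derivation F K K) {n : Type*} [Finite n]
    {e : n → K} (he : LinearIndependent (derivationConstants D) e) (j : n) :
    ∃ T ∈ differentialOperators R D, T (e j) ≠ 0 ∧ ∀ i ≠ j, T (e i) = 0 := by
  classical
  have := Fintype.ofFinite n
  have hne : ∀ {b}, b ∉ P → algebraMap R K b ≠ 0 :=
    fun hb h => hb ((hK.algebraMap_eq_zero_iff _).1 h)
  let W : Submodule K (n → K) :=
    { carrier := {v | ∃ s ∉ P, ∃ T ∈ differentialOperators R D,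
        ∀ i, algebraMap R K s * v i = T (e i)}
      zero_mem' := ⟨1, hP.one_notMem, 0, zero_mem _, by simp⟩
      add_mem' := by
        rintro v w ⟨s, hs, S, hS, hSv⟩ ⟨t, ht, T, hT, hTw⟩
        refine ⟨s * t, hP.mul_notMem hs ht, _, add_mem
          (mul_mem (mulLeft_mem_differentialOperators D t) hS)
          (mul_mem (mulLeft_mem_differentialOperators D s) hT), fun i => ?_⟩
        simp only [map_mul, Pi.add_apply, LinearMap.add_apply, Module.End.mul_apply,
          LinearMap.mulLeft_apply, ← hSv, ← hTw]
        ring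
      smul_mem' := by
        rintro x v ⟨s, hs, S, hS, hSv⟩
        obtain ⟨a, b, hb, hx⟩ := hK.exists_mul_eq x
        refine ⟨b * s, hP.mul_notMem hb hs, _,
          mul_mem (mulLeft_mem_differentialOperators D a) hS, fun i => ?_⟩
        simp only [map_mul, Pi.smul_apply, smul_eq_mul, Module.End.mul_apply,
          LinearMap.mulLeft_apply, ← hSv, ← hx]
        ring }
  have hW : W = ⊤ := by
    by_contra hW
    obtain ⟨f, hf0, hf⟩ := Submodule.exists_le_ker_of_lt_top W (lt_top_iff_ne_top.2 hW)
    let N : Submodule K (n → K) :=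
      { carrier := {c | ∀ T ∈ differentialOperators R D, ∑ i, c i * T (e i) = 0}
        zero_mem' := by simp
        add_mem' := fun {c d} hc hd T hT => by
          simp [add_mul, Finset.sum_add_distrib, hc T hT, hd T hT]
        smul_mem' := fun x c hc T hT => by
          simp [mul_assoc, ← Finset.mul_sum, hc T hT] }
    have hN : ∀ i, ∀ c ∈ N, (fun l => D i (c l)) ∈ N := by
      intro i c hc T hT
      have h1 := hc _ (mul_mem (derivationConstantsLinear_mem_differentialOperators D i) hT)
      have h2 := congrArg (D i) (hc T hT)
      simp only [Module.End.mul_apply, derivationConstantsLinear_apply] at h1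
      simp only [map_sum, Derivation.leibniz, smul_eq_mul, Finset.sum_add_distrib, h1,
        map_zero, zero_add] at h2
      simpa only [mul_comm] using h2
    have hN0 : N ≠ ⊥ := by
      have hf' : ∀ v, f v = ∑ i, f (Pi.single i 1) * v i := fun v => by
        conv_lhs => rw [pi_eq_sum_univ' v]
        simp only [map_sum, map_smul, smul_eq_mul]
        refine Finset.sum_congr rfl fun i _ => ?_
        rw [mul_comm]
      refine N.ne_bot_iff.2 ⟨fun i => f (Pi.single i 1), fun T hT => ?_, fun h0 => hf0 ?_⟩
      · rw [← hf' fun i => T (e i)]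
        exact hf ⟨1, hP.one_notMem, T, hT, by simp⟩
      · ext v
        simp [congrFun h0 v]
    obtain ⟨c, hcN, hc0, hc⟩ := exists_mem_forall_mem_derivationConstants D N hN hN0
    refine hc0 (funext fun i => ?_)
    have h1 := Fintype.linearIndependent_iff.1 he (fun i => ⟨c i, hc i⟩)
      (by simpa [Subfield.smul_def] using hcN 1 (one_mem _)) i
    exact congrArg Subtype.val h1
  obtain ⟨s, hs, T, hT, h⟩ : Pi.single j 1 ∈ W := hW ▸ Submodule.mem_top
  refine ⟨T, hT, ?_, fun i hi => ?_⟩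
  · rw [← h j, Pi.single_eq_same, mul_one]
    exact hne hs
  · rw [← h i, Pi.single_eq_of_ne hi, mul_zero]

end DifferentialOperators

section Rational

variable {k R K : Type u} [Field k] [CommRing R] [Algebra k R] [Field K] [Algebra k K]
  [Algebra R K] [IsScalarTower k R K] {Δ : Set (Derivation k R R)} {P : Ideal R}
  {D : Δ → Derivation k K K}

theorem isDeltaRational_iff {P : Ideal R} (hP : P.IsPrime)
    {D : Δ → Derivation k (FractionRing (R ⧸ P)) (FractionRing (R ⧸ P))}
    (hD : ∀ δ r, D δ (algebraMap R _ r) = algebraMap R _ ((δ : Derivation k R R) r)) :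
    IsDeltaRational k R Δ P hP ↔ ∀ x ∈ derivationConstants D, IsAlgebraic k x := by
  have hK := isResidueFractionField_fractionRing P
  have hne : ∀ {b}, b ∉ P → algebraMap R (FractionRing (R ⧸ P)) b ≠ 0 :=
    fun hb h => hb ((hK.algebraMap_eq_zero_iff _).1 h)
  have hconst : ∀ {x : FractionRing (R ⧸ P)} {a b : R}, b ∉ P →
      x * algebraMap R _ b = algebraMap R _ a →
      (x ∈ derivationConstants D ↔ ∀ δ ∈ Δ, δ a * b - a * δ b ∈ P) := by
    intro x a b hb hx
    have hkey : ∀ δ : Δ, algebraMap R (FractionRing (R ⧸ P))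
        ((δ : Derivation k R R) a * b - a * (δ : Derivation k R R) b) =
        D δ x * (algebraMap R _ b * algebraMap R _ b) := fun δ => by
      have h1 := congrArg (D δ) hx
      rw [Derivation.leibniz, hD, hD, smul_eq_mul, smul_eq_mul] at h1
      rw [map_sub, map_mul, map_mul, ← h1, ← hx]
      ring
    rw [mem_derivationConstants, Subtype.forall]
    refine forall₂_congr fun δ hδ => ?_
    have h2 := hkey ⟨δ, hδ⟩
    rw [← hK.algebraMap_eq_zero_iff, h2, mul_eq_zero, or_iff_left (mul_ne_zero (hne hb) (hne hb))]
  constructor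
  · intro h x hx
    obtain ⟨a, b, hb, hab⟩ := hK.exists_mul_eq x
    rw [eq_div_of_mul_eq (hne hb) hab]
    exact h a b hb ((hconst hb hab).1 hx)
  · intro h a b hb hab
    refine h _ ((hconst hb ?_).2 hab)
    exact div_mul_cancel₀ _ (hne hb)

omit [IsScalarTower k R K] in
theorem exists_mul_mem_range_of_mem_derivationConstants {M : Ideal R} (hM : deltaCore k R Δ M = P)
    (hK : IsResidueFractionField P K)
    (hD : ∀ δ r, D δ (algebraMap R K r) = algebraMap R K ((δ : Derivation k R R) r))
    {x : K} (hx : x ∈ derivationConstants D) :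
    ∃ s ∉ M, ∃ c, x * algebraMap R K s = algebraMap R K c := by
  let I : Ideal R :=
    { carrier := {r | ∃ c, x * algebraMap R K r = algebraMap R K c}
      zero_mem' := ⟨0, by simp⟩
      add_mem' := by
        rintro r s ⟨c, hc⟩ ⟨d, hd⟩
        exact ⟨c + d, by rw [map_add, map_add, mul_add, hc, hd]⟩
      smul_mem' := by
        rintro r s ⟨c, hc⟩
        exact ⟨r * c, by rw [smul_eq_mul, map_mul, map_mul, ← hc]; ring⟩ }
  have hI : IsDeltaIdeal k R Δ I := by
    rintro δ hδ r ⟨c, hc⟩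
    refine ⟨δ c, ?_⟩
    have h := congrArg (D ⟨δ, hδ⟩) hc
    rwa [Derivation.leibniz, hD, hD, hx, smul_zero, add_zero, smul_eq_mul] at h
  by_contra! h
  obtain ⟨a, b, hb, hab⟩ := hK.exists_mul_eq x
  refine hb (hM ▸ hI.le_deltaCore (J := M) (fun r hr => ?_) ⟨a, hab⟩)
  by_contra hrM
  obtain ⟨c, hc⟩ := hr
  exact h r hrM c hc

theorem isAlgebraic_of_mem_derivationConstants (hrank : Module.rank k R < Cardinal.mk k)
    {M : Ideal R} [hMmax : M.IsMaximal] (hM : deltaCore k R Δ M = P)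
    (hK : IsResidueFractionField P K)
    (hD : ∀ δ r, D δ (algebraMap R K r) = algebraMap R K ((δ : Derivation k R R) r))
    {x : K} (hx : x ∈ derivationConstants D) : IsAlgebraic k x := by
  let _ : Field (R ⧸ M) := Ideal.Quotient.field M
  have hMp : M.IsPrime := hMmax.isPrime
  have halg : Algebra.IsAlgebraic k (R ⧸ M) := Algebra.isAlgebraic_of_rank_lt_mk
    ((LinearMap.rank_le_of_surjective (Ideal.Quotient.mkₐ k M).toLinearMap
      (Ideal.Quotient.mkₐ_surjective k M)).trans_lt hrank)
  have hPM : P ≤ M := hM ▸ deltaCore_le M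
  obtain ⟨s, hs, c, hsc⟩ := exists_mul_mem_range_of_mem_derivationConstants hM hK hD hx
  have hs0 : algebraMap R (R ⧸ M) s ≠ 0 := fun h => hs (Ideal.Quotient.eq_zero_iff_mem.1 h)
  obtain ⟨y, hy⟩ : ∃ y : R ⧸ M, y * algebraMap R (R ⧸ M) s = algebraMap R (R ⧸ M) c :=
    ⟨_, div_mul_cancel₀ _ hs0⟩
  obtain ⟨p, hp0, hp⟩ := halg.isAlgebraic y
  have heval : ∀ q : Polynomial k, ∃ t ∉ M, ∃ d,
      Polynomial.aeval x q * algebraMap R K t = algebraMap R K d ∧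
      Polynomial.aeval y q * algebraMap R (R ⧸ M) t = algebraMap R (R ⧸ M) d := by
    intro q
    induction q using Polynomial.induction_on with
    | C a =>
      refine ⟨1, hMp.one_notMem, algebraMap k R a, ?_, ?_⟩ <;>
      simp [← IsScalarTower.algebraMap_apply]
    | add f g hf hg =>
      obtain ⟨t, ht, d, h1, h2⟩ := hf
      obtain ⟨t', ht', d', h1', h2'⟩ := hg
      refine ⟨t * t', hMp.mul_notMem ht ht', d * t' + d' * t, ?_, ?_⟩
      · simp only [map_add, map_mul, ← h1, ← h1']; ring
      · simp only [map_add, map_mul, ← h2, ← h2']; ring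
    | monomial n a h =>
      obtain ⟨t, ht, d, h1, h2⟩ := h
      refine ⟨t * s, hMp.mul_notMem ht hs, d * c, ?_, ?_⟩
      · rw [pow_succ, ← mul_assoc]
        simp only [map_mul _ _ c, map_mul _ t, map_mul _ _ Polynomial.X, Polynomial.aeval_X,
          ← h1, ← hsc]
        ring
      · rw [pow_succ, ← mul_assoc]
        simp only [map_mul _ _ c, map_mul _ t, map_mul _ _ Polynomial.X, Polynomial.aeval_X,
          ← h2, ← hy]
        ring
  refine ⟨p, hp0, ?_⟩
  by_contra hpx
  obtain ⟨t, ht, d, h1, h2⟩ := heval p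
  rw [hp, zero_mul] at h2
  have hdM : d ∈ M := Ideal.Quotient.eq_zero_iff_mem.1 h2.symm
  have hpC : Polynomial.aeval x p ∈ derivationConstants D := fun δ => by
    have hk : ∀ a : k, algebraMap k K a ∈ derivationConstants D := fun a δ => by simp
    refine Polynomial.induction_on (motive := fun q => Polynomial.aeval x q ∈ derivationConstants D)
      p (fun a => ?_) (fun f g hf hg => ?_) (fun n a h => ?_) δ
    · simpa using hk a
    · simpa using add_mem hf hg
    · simpa using mul_mem (hk a) (pow_mem hx (n + 1))
  obtain ⟨t', ht', d', h'⟩ :=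
    exists_mul_mem_range_of_mem_derivationConstants hM hK hD (inv_mem hpC)
  have hmem : t' * t - d' * d ∈ P := by
    rw [← hK.algebraMap_eq_zero_iff, map_sub, map_mul, map_mul, ← h1, ← h']
    field_simp
    ring
  refine hMp.mul_notMem ht' ht ?_
  have := add_mem (hPM hmem) (M.mul_mem_left d' hdM)
  rwa [sub_add_cancel] at this

theorem mem_of_isAlgebraic_of_mul_mem (hK : IsResidueFractionField P K) {Q : Ideal R}
    (hQ : Q.IsPrime) (hPQ : P ≤ Q) {x : K} (hx : IsAlgebraic k x) (hx0 : x ≠ 0) {s r : R}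
    (hr : r ∈ Q) (h : x * algebraMap R K s = algebraMap R K r) : s ∈ Q := by
  have hint : IsIntegral k x⁻¹ := hx.inv.isIntegral
  obtain ⟨p, hp, hpx⟩ := hint
  have hs : algebraMap R K s = x⁻¹ * algebraMap R K r := by rw [← h, inv_mul_cancel_left₀ hx0]
  let n := p.natDegree
  let q : R := ∑ i ∈ Finset.range n, algebraMap k R (p.coeff i) * (s ^ i * r ^ (n - i))
  have hq : q ∈ Q := sum_mem fun i hi => Q.mul_mem_left _ (Q.mul_mem_left _
    (Q.pow_mem_of_mem hr _ (Nat.sub_pos_of_lt (Finset.mem_range.1 hi))))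
  have hsum : s ^ n + q ∈ P := by
    rw [← hK.algebraMap_eq_zero_iff]
    have h1 := congrArg (· * algebraMap R K r ^ n) hpx
    simp only [zero_mul, Polynomial.eval₂_eq_sum_range, Finset.sum_range_succ,
      hp.coeff_natDegree, map_one, one_mul, add_mul, Finset.sum_mul] at h1
    rw [← h1, add_comm]
    simp only [q, map_add, map_sum, map_mul, map_pow, hs, mul_pow,
      ← IsScalarTower.algebraMap_apply]
    congr 1
    refine Finset.sum_congr rfl fun i hi => ?_
    rw [mul_assoc, mul_assoc, ← pow_add, Nat.add_sub_of_le (Finset.mem_range.1 hi).le]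
  refine hQ.mem_of_pow_mem n ?_
  have := sub_mem (hPQ hsum) hq
  rwa [add_sub_cancel_right] at this

theorem Cardinal.mk_finset_lt {α : Type u} {κ : Cardinal.{u}} (h : Cardinal.mk α < κ)
    (hκ : Cardinal.aleph0 ≤ κ) : Cardinal.mk (Finset α) < κ := by
  rcases finite_or_infinite α with hα | hα
  · exact (Cardinal.lt_aleph0_of_finite _).trans_le hκ
  · rwa [Cardinal.mk_finset_of_infinite]

theorem exists_set_of_derivationConstants_isAlgebraic [hP : P.IsPrime] {κ : Cardinal.{u}}
    (hκ : Cardinal.aleph0 ≤ κ) (hrank : Module.rank k R < κ)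
    (hK : IsResidueFractionField P K)
    (hD : ∀ δ r, D δ (algebraMap R K r) = algebraMap R K ((δ : Derivation k R R) r))
    (halg : ∀ x ∈ derivationConstants D, IsAlgebraic k x) :
    ∃ S : Set R, (∀ s ∈ S, s ∉ P) ∧ Cardinal.mk S < κ ∧
      ∀ Q : Ideal R, IsDeltaPrime k R Δ Q → P < Q → ∃ s ∈ S, s ∈ Q := by
  classical
  obtain ⟨b, hb, hspan, hli⟩ :=
    exists_linearIndependent (derivationConstants D) (Set.range (algebraMap R K))
  choose g hg using fun x : b => hb x.2
  have hgli : LinearIndependent k g := by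
    have hk : LinearIndependent k ((↑) : b → K) := by
      let i : k →+* derivationConstants D :=
        (algebraMap k K).codRestrict (derivationConstants D) fun a δ => by simp
      rw [linearIndependent_iff'] at hli ⊢
      intro t c hc j hj
      have := hli t (fun l => i (c l)) ((Finset.sum_congr rfl fun l _ =>
        (Algebra.smul_def (c l) (l : K)).symm).trans hc) j hj
      exact (map_eq_zero i).1 this
    refine LinearIndependent.of_comp (IsScalarTower.toAlgHom k R K).toLinearMap ?_
    convert hk using 1
    exact funext hg
  have hbcard : Cardinal.mk b < κ := hgli.cardinal_le_rank.trans_lt hrank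
  have hstab : ∀ Q : Ideal R, IsDeltaIdeal k R Δ Q →
      ∀ δ : Δ, ∀ r ∈ Q, ∃ r' ∈ Q, D δ (algebraMap R K r) = algebraMap R K r' :=
    fun Q hQ δ r hr => ⟨_, hQ δ δ.2 r hr, hD δ r⟩
  have hsep : ∀ t : Finset b, ∃ s ∉ P, ∀ Q : Ideal R, IsDeltaPrime k R Δ Q → P < Q →
      ∀ r ∈ Q, r ∉ P → ∀ c : b →₀ derivationConstants D, c.support = t →
      Finsupp.linearCombination (derivationConstants D) ((↑) : b → K) c = algebraMap R K r →
      s ∈ Q := by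
    intro t
    rcases t.eq_empty_or_nonempty with rfl | ⟨j, hj⟩
    · refine ⟨1, hP.one_notMem, fun Q _ _ r _ hrP c hc hcr => (hrP ?_).elim⟩
      rw [← hK.algebraMap_eq_zero_iff, ← hcr, Finsupp.support_eq_empty.1 hc, map_zero]
    · obtain ⟨T, hT, hTj, hTi⟩ := exists_differentialOperator_separating hK D
        (hli.comp ((↑) : t → b) Subtype.val_injective) ⟨j, hj⟩
      obtain ⟨s, -, hs⟩ := exists_mem_of_mem_differentialOperators
        (hstab ⊤ fun _ _ _ _ => Submodule.mem_top) hT (Submodule.mem_top (x := g j))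
      rw [hg] at hs
      refine ⟨s, fun h => hTj (hs.trans ((hK.algebraMap_eq_zero_iff s).2 h)),
        fun Q hQ hPQ r hr _ c hc hcr => ?_⟩
      obtain ⟨r', hr', hTr⟩ := exists_mem_of_mem_differentialOperators (hstab Q hQ.2) hT hr
      have hcj : c j ≠ 0 := Finsupp.mem_support_iff.1 (hc ▸ hj)
      refine mem_of_isAlgebraic_of_mul_mem hK hQ.1 hPQ.le (halg _ (c j).2)
        (fun h => hcj (Subtype.ext h)) hr' ?_
      rw [← hTr, ← hcr, Finsupp.linearCombination_apply, Finsupp.sum, hc, map_sum,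
        Finset.sum_eq_single_of_mem j hj, map_smul, ← hs, Subfield.smul_def, smul_eq_mul]
      intro i hi hij
      rw [map_smul, show T (i : K) = 0 from hTi ⟨i, hi⟩ fun h => hij (congrArg Subtype.val h),
        smul_zero]
  choose s hsP hs using hsep
  refine ⟨Set.range s, ?_, Cardinal.mk_range_le.trans_lt (Cardinal.mk_finset_lt hbcard hκ),
    fun Q hQ hPQ => ?_⟩
  · rintro _ ⟨t, rfl⟩
    exact hsP t
  · obtain ⟨r, hrQ, hrP⟩ := SetLike.exists_of_lt hPQ
    have hmem : algebraMap R K r ∈ Submodule.span (derivationConstants D) b :=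
      hspan ▸ Submodule.subset_span ⟨r, rfl⟩
    rw [Finsupp.mem_span_iff_linearCombination] at hmem
    obtain ⟨c, hc⟩ := hmem
    exact ⟨_, ⟨c.support, rfl⟩, hs _ Q hQ hPQ r hrQ hrP c rfl hc⟩

end Rational

section Primitive

variable {k R : Type u} [Field k] [CommRing R] [Algebra k R] {Δ : Set (Derivation k R R)}
  {P : Ideal R}

theorem exists_maximal_forall_notMem [hP : P.IsPrime] (hrank : Module.rank k R < Cardinal.mk k)
    (hk : Cardinal.aleph0 < Cardinal.mk k) {S : Set R} (hS : ∀ s ∈ S, s ∉ P)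
    (hcard : Cardinal.mk S < Cardinal.mk k) :
    ∃ M : Ideal R, M.IsMaximal ∧ P ≤ M ∧ ∀ s ∈ S, s ∉ M := by
  let K := FractionRing (R ⧸ P)
  have hK : IsResidueFractionField P K := isResidueFractionField_fractionRing P
  obtain ⟨b⟩ : Nonempty (Module.Basis (Module.Basis.ofVectorSpaceIndex k R) k R) :=
    ⟨Module.Basis.ofVectorSpace k R⟩
  let G : Set K := Set.range (fun i => algebraMap R K (b i)) ∪
    Set.range (fun s : S => (algebraMap R K s)⁻¹)
  have hG : Cardinal.mk G < Cardinal.mk k := by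
    refine (Cardinal.mk_union_le _ _).trans_lt (Cardinal.add_lt_of_lt hk.le ?_ ?_)
    · exact Cardinal.mk_range_le.trans_lt (b.mk_eq_rank''.trans_lt hrank)
    · exact Cardinal.mk_range_le.trans_lt hcard
  let B := Algebra.adjoin k G
  have hB : Module.rank k B < Cardinal.mk k :=
    (Algebra.rank_adjoin_le G).trans_lt (max_lt hG hk)
  have hRB : ∀ r, algebraMap R K r ∈ B := fun r => by
    induction b.mem_span r using Submodule.span_induction with
    | mem x hx =>
      obtain ⟨i, rfl⟩ := hx
      exact Algebra.subset_adjoin (.inl ⟨i, rfl⟩)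
    | zero => rw [map_zero]; exact zero_mem _
    | add x y _ _ hx hy => rw [map_add]; exact add_mem hx hy
    | smul c x _ hx =>
      rw [Algebra.smul_def, map_mul, ← IsScalarTower.algebraMap_apply]
      exact mul_mem (B.algebraMap_mem c) hx
  obtain ⟨m, hm⟩ := Ideal.exists_maximal B
  let _ : Field (B ⧸ m) := Ideal.Quotient.field m
  have halg : Algebra.IsAlgebraic k (B ⧸ m) := Algebra.isAlgebraic_of_rank_lt_mk
    ((LinearMap.rank_le_of_surjective (Ideal.Quotient.mkₐ k m).toLinearMap
      (Ideal.Quotient.mkₐ_surjective k m)).trans_lt hB)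
  let i : R →ₐ[k] B := (IsScalarTower.toAlgHom k R K).codRestrict B hRB
  let f : R →ₐ[k] B ⧸ m := (Ideal.Quotient.mkₐ k m).comp i
  refine ⟨RingHom.ker f, ?_, fun r hr => ?_, fun s hs hsf => ?_⟩
  · refine Ideal.Quotient.maximal_of_isField _ ?_
    exact (Ideal.quotientKerEquivRange f).toMulEquiv.isField
      f.range.isField_of_algebraic
  · have : i r = 0 := Subtype.ext ((hK.algebraMap_eq_zero_iff r).2 hr)
    simp [f, RingHom.mem_ker, this]
  · have hne : algebraMap R K s ≠ 0 := fun h => hS s hs ((hK.algebraMap_eq_zero_iff s).1 h)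
    have hu : i s * (⟨_, Algebra.subset_adjoin (.inr ⟨⟨s, hs⟩, rfl⟩)⟩ : B) = 1 :=
      Subtype.ext (mul_inv_cancel₀ hne)
    have h1 := congrArg (Ideal.Quotient.mkₐ k m) hu
    rw [map_mul, map_one, show Ideal.Quotient.mkₐ k m (i s) = 0 from hsf, zero_mul] at h1
    exact zero_ne_one h1

theorem isDeltaPrimitive_of_set [CharZero k] [hP : P.IsPrime] (hPΔ : IsDeltaIdeal k R Δ P)
    (hrank : Module.rank k R < Cardinal.mk k) {S : Set R} (hS : ∀ s ∈ S, s ∉ P)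
    (hcard : Cardinal.mk S < Cardinal.mk k)
    (h : ∀ Q : Ideal R, IsDeltaPrime k R Δ Q → P < Q → ∃ s ∈ S, s ∈ Q) :
    IsDeltaPrimitive k R Δ P := by
  rcases (Cardinal.aleph0_le_mk k).lt_or_eq with hk | hk
  · obtain ⟨M, hM, hPM, hSM⟩ := exists_maximal_forall_notMem hrank hk hS hcard
    refine ⟨M, hM, ?_⟩
    have := hM.isPrime
    by_contra hne
    obtain ⟨s, hs, hsM⟩ := h (deltaCore k R Δ M) ⟨deltaCore_isPrime M, isDeltaIdeal_deltaCore M⟩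
      ((hPΔ.le_deltaCore hPM).lt_of_ne (Ne.symm hne))
    exact hSM s hs (deltaCore_le M hsM)
  · have hfin : Module.Finite k R := Module.rank_lt_aleph0_iff.1 (hk ▸ hrank)
    have := hP
    have hmax : P.IsMaximal := by
      have : IsArtinianRing R := IsArtinianRing.of_finite k R
      infer_instance
    exact ⟨P, hmax, le_antisymm (deltaCore_le P) (hPΔ.le_deltaCore le_rfl)⟩

end Primitive

/-- If `R` is noetherian with `dim_k R < |k|` and `|Δ| < |k|`, then for a `Δ`-prime ideal `P`
the following are equivalent: `P` is `Δ`-primitive; `P` is `Δ`-rational; `P` is `|k|`-separable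
in `Δ`-spec `R`. -/
theorem primitive_rational_separable_tfae (k R : Type u) [Field k] [CharZero k] [CommRing R]
    [Algebra k R] [IsNoetherianRing R]
    (hrank : Module.rank k R < Cardinal.mk k)
    (Δ : Set (Derivation k R R)) (hΔ : Cardinal.mk Δ < Cardinal.mk k)
    (P : Ideal R) (hP : P.IsPrime) (hPΔ : IsDeltaIdeal k R Δ P) :
    List.TFAE [
      IsDeltaPrimitive k R Δ P,
      IsDeltaRational k R Δ P hP,
      DeltaSeparable k R Δ (Cardinal.mk k) P] := by
  have hκ : Cardinal.aleph0 ≤ Cardinal.mk k := Cardinal.aleph0_le_mk k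
  have hK := isResidueFractionField_fractionRing P
  choose D hD using fun δ : Δ => hK.exists_derivation hP δ.1 (hPΔ δ δ.2)
  rw [deltaSeparable_iff_exists_set hκ, isDeltaRational_iff hP hD]
  tfae_have 1 → 2 := fun ⟨M, hM, hMP⟩ _ hx =>
    isAlgebraic_of_mem_derivationConstants hrank hMP hK hD hx
  tfae_have 2 → 3 := fun h => exists_set_of_derivationConstants_isAlgebraic hκ hrank hK hD h
  tfae_have 3 → 1 := fun ⟨_, hS, hcard, h⟩ => isDeltaPrimitive_of_set hPΔ hrank hS hcard h
  tfae_finish
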